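/- Gronwall–Mittag-Leffler estimate: Let μ > 0, let u, v : [a,b] → ℝ be nonnegative and integrable with v nondecreasing, and let w : [a,b] → ℝ be continuous, nonnegative and nondecreasing. If u(ℓ) ≤ v(ℓ) + w(ℓ) ∫_a^ℓ Φ'(ρ)(Φ(ℓ)−Φ(ρ))^{μ−1} u(ρ) dρ for all ℓ ∈ [a,b], then u(ℓ) ≤ v(ℓ) · E_μ( Γ(μ) w(ℓ) (Φ(ℓ)−Φ(a))^μ ) for all ℓ ∈ [a,b]. -/

import Mathlib

open Real MeasureTheory Set

/-- One-parameter Mittag-Leffler function `E_p(x) = ∑_{k=0}^∞ x^k / Γ(pk+1)`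
(as `E_{p,q}` with `q = 1`). -/
noncomputable def mittagLeffler (p q x : ℝ) : ℝ :=
  ∑' k : ℕ, x ^ k / Real.Gamma (p * k + q)

open Filter Topology
open scoped ENNReal

/-- Bounding the Gamma integral below by its part over `(R, ∞)`. -/
lemma rpow_mul_exp_neg_le_Gamma {s R : ℝ} (hs : 1 ≤ s) (hR : 0 < R) :
    R ^ (s - 1) * Real.exp (-R) ≤ Real.Gamma s := by
  have hint := Real.GammaIntegral_convergent (s := s) (by linarith)
  have hsub : Ioi R ⊆ Ioi (0 : ℝ) := Ioi_subset_Ioi hR.le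
  have hexp : IntegrableOn (fun x : ℝ => Real.exp (-x)) (Ioi R) := integrableOn_exp_neg_Ioi R
  rw [Real.Gamma_eq_integral (by linarith)]
  calc R ^ (s - 1) * Real.exp (-R) = ∫ x in Ioi R, R ^ (s - 1) * Real.exp (-x) := by
        rw [integral_const_mul, integral_exp_neg_Ioi]
    _ ≤ ∫ x in Ioi R, Real.exp (-x) * x ^ (s - 1) := by
        refine setIntegral_mono_on (hexp.const_mul _) (hint.mono_set hsub) measurableSet_Ioi ?_
        intro x hx
        have hRx : R ≤ x := le_of_lt hx
        rw [mul_comm]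
        gcongr
    _ ≤ ∫ x in Ioi 0, Real.exp (-x) * x ^ (s - 1) := by
        refine setIntegral_mono_set hint ?_ hsub.eventuallyLE
        filter_upwards [ae_restrict_mem measurableSet_Ioi] with x hx
        have : (0 : ℝ) < x := hx
        simp only [Pi.zero_apply]
        positivity

lemma summable_pow_div_Gamma {p : ℝ} (hp : 0 < p) (q : ℝ) {x : ℝ} (hx : 0 ≤ x) :
    Summable fun k : ℕ => x ^ k / Real.Gamma (p * k + q) := by
  set R : ℝ := (2 * x + 1) ^ (1 / p) with hRdef
  have hR : 0 < R := by positivity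
  have hRp : R ^ p = 2 * x + 1 := by
    rw [hRdef, ← Real.rpow_mul (by positivity), one_div_mul_cancel hp.ne', Real.rpow_one]
  have hgeom : Summable fun k : ℕ =>
      Real.exp R * R ^ (1 - q) * (x / (2 * x + 1)) ^ k := by
    refine (summable_geometric_of_lt_one (by positivity) ?_).mul_left _
    rw [div_lt_one (by positivity)]
    linarith
  refine Summable.of_norm_bounded_eventually_nat hgeom ?_
  have hlarge : ∀ᶠ k : ℕ in atTop, 1 ≤ p * k + q :=
    (tendsto_atTop_add_const_right _ q
      (tendsto_natCast_atTop_atTop.const_mul_atTop hp)).eventually_ge_atTop 1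
  filter_upwards [hlarge] with k hk
  have hΓ := rpow_mul_exp_neg_le_Gamma hk hR
  rw [Real.norm_of_nonneg (div_nonneg (by positivity) (Real.Gamma_nonneg_of_nonneg (by linarith)))]
  calc x ^ k / Real.Gamma (p * k + q)
      ≤ x ^ k / (R ^ (p * k + q - 1) * Real.exp (-R)) := by gcongr
    _ = Real.exp R * R ^ (1 - q) * (x / (2 * x + 1)) ^ k := by
        rw [← hRp, div_pow, ← Real.rpow_mul_natCast hR.le, Real.exp_neg,
          show p * k + q - 1 = p * k - (1 - q) by ring, Real.rpow_sub hR]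
        have := (Real.rpow_pos_of_pos hR (1 - q)).ne'
        have := (Real.rpow_pos_of_pos hR (p * k)).ne'
        have := (Real.exp_pos R).ne'
        field_simp

lemma one_le_mittagLeffler {p x : ℝ} (hp : 0 < p) (hx : 0 ≤ x) : 1 ≤ mittagLeffler p 1 x := by
  have h := (summable_pow_div_Gamma hp 1 hx).le_tsum 0 fun k _ =>
    div_nonneg (by positivity) (Real.Gamma_nonneg_of_nonneg (by positivity))
  simpa [mittagLeffler] using h

/-- The Riemann–Liouville kernel `t ^ (α - 1) / Γ(α)`, supported on `t > 0`. -/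
noncomputable def rlKernel (α t : ℝ) : ℝ≥0∞ :=
  if 0 < t then ENNReal.ofReal (t ^ (α - 1) / Real.Gamma α) else 0

lemma rlKernel_of_pos {α t : ℝ} (ht : 0 < t) :
    rlKernel α t = ENNReal.ofReal (t ^ (α - 1) / Real.Gamma α) := if_pos ht

lemma rlKernel_of_nonpos {α t : ℝ} (ht : t ≤ 0) : rlKernel α t = 0 := if_neg ht.not_gt

@[fun_prop]
lemma measurable_rlKernel (α : ℝ) : Measurable (rlKernel α) :=
  Measurable.ite measurableSet_Ioi (by fun_prop) measurable_const

lemma rlKernel_lconvolution_rlKernel {α β : ℝ} (hα : 0 < α) (hβ : 0 < β) :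
    rlKernel α ⋆ₗ rlKernel β = rlKernel (α + β) := by
  ext t
  rw [lconvolution_def]
  rcases le_or_gt t 0 with ht | ht
  · rw [rlKernel_of_nonpos ht]
    refine (lintegral_congr fun y => ?_).trans lintegral_zero
    rcases le_or_gt y 0 with hy | hy
    · rw [rlKernel_of_nonpos hy, zero_mul]
    · rw [rlKernel_of_nonpos (by linarith : -y + t ≤ 0), mul_zero]
  · have hscale : ∀ F : ℝ → ℝ≥0∞, Measurable F →
        ∫⁻ y, F y = ∫⁻ x, ENNReal.ofReal t * F (t * x) := by
      intro F hF
      conv_lhs => rw [← Real.smul_map_volume_mul_left ht.ne']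
      rw [lintegral_smul_measure, lintegral_map hF (by fun_prop), abs_of_pos ht, smul_eq_mul,
        lintegral_const_mul _ (by fun_prop)]
    rw [hscale _ (by fun_prop)]
    calc ∫⁻ x, ENNReal.ofReal t * (rlKernel α (t * x) * rlKernel β (-(t * x) + t))
        = ∫⁻ x, rlKernel (α + β) t * ProbabilityTheory.betaPDF α β x := by
          refine lintegral_congr fun x => ?_
          rcases le_or_gt x 0 with hx | hx
          · rw [rlKernel_of_nonpos (mul_nonpos_of_nonneg_of_nonpos ht.le hx),
              ProbabilityTheory.betaPDF_eq_zero_of_nonpos hx]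
            simp
          rcases le_or_gt 1 x with hx1 | hx1
          · rw [rlKernel_of_nonpos (by nlinarith : -(t * x) + t ≤ 0),
              ProbabilityTheory.betaPDF_eq_zero_of_one_le hx1]
            simp
          have hx1' : 0 < 1 - x := by linarith
          rw [show -(t * x) + t = t * (1 - x) by ring, rlKernel_of_pos (by positivity),
            rlKernel_of_pos (by positivity), rlKernel_of_pos ht,
            ProbabilityTheory.betaPDF_of_pos_lt_one hx hx1, ProbabilityTheory.beta]
          have h1 := Real.Gamma_pos_of_pos hα
          have h2 := Real.Gamma_pos_of_pos hβ
          have h3 := Real.Gamma_pos_of_pos (add_pos hα hβ)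
          rw [← ENNReal.ofReal_mul (by positivity), ← ENNReal.ofReal_mul (by positivity),
            ← ENNReal.ofReal_mul (by positivity)]
          congr 1
          rw [Real.mul_rpow ht.le hx.le, Real.mul_rpow ht.le hx1'.le,
            show α + β - 1 = 1 + (α - 1) + (β - 1) by ring, Real.rpow_add ht, Real.rpow_add ht,
            Real.rpow_one]
          field_simp
      _ = rlKernel (α + β) t := by
          rw [lintegral_const_mul _ (by unfold ProbabilityTheory.betaPDF; fun_prop),
            ProbabilityTheory.lintegral_betaPDF_eq_one hα hβ, mul_one]

section Volterra

variable {g : ℝ → ℝ≥0∞} {V c : ℝ≥0∞} {μ : ℝ}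

lemma lconvolution_rlKernel_le (hμ : 0 < μ) (hgm : AEMeasurable g)
    (hg : ∀ t, g t ≤ V * rlKernel 1 t + c * (g ⋆ₗ rlKernel μ) t) {α : ℝ} (hα : 0 < α) (t : ℝ) :
    (g ⋆ₗ rlKernel α) t ≤ V * rlKernel (1 + α) t + c * (g ⋆ₗ rlKernel (μ + α)) t := by
  have hconv : AEMeasurable (g ⋆ₗ rlKernel μ) :=
    aemeasurable_lconvolution hgm (measurable_rlKernel μ).aemeasurable
  rw [← rlKernel_lconvolution_rlKernel one_pos hα, ← rlKernel_lconvolution_rlKernel hμ hα,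
    lconvolution_assoc₀ hgm (measurable_rlKernel μ).aemeasurable
      (measurable_rlKernel α).aemeasurable]
  calc (g ⋆ₗ rlKernel α) t
      ≤ ∫⁻ y, (V * (rlKernel 1 y * rlKernel α (-y + t)) +
          c * ((g ⋆ₗ rlKernel μ) y * rlKernel α (-y + t))) := by
        rw [lconvolution_def]
        refine lintegral_mono fun y => ?_
        rw [← mul_assoc, ← mul_assoc, ← add_mul]
        gcongr
        exact hg y
    _ = _ := by
        rw [lintegral_add_left (by fun_prop), lintegral_const_mul _ (by fun_prop),
          lintegral_const_mul'' _ (by fun_prop)]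
        rfl

lemma le_sum_rlKernel_add (hμ : 0 < μ) (hgm : AEMeasurable g)
    (hg : ∀ t, g t ≤ V * rlKernel 1 t + c * (g ⋆ₗ rlKernel μ) t) (n : ℕ) (t : ℝ) :
    g t ≤ V * ∑ j ∈ Finset.range (n + 1), c ^ j * rlKernel (μ * j + 1) t +
      c ^ (n + 1) * (g ⋆ₗ rlKernel (μ * (n + 1 : ℕ))) t := by
  induction n with
  | zero => simpa using hg t
  | succ n ih =>
    have hα : 0 < μ * (n + 1 : ℕ) := by positivity
    refine (ih.trans (add_le_add_right
      (mul_le_mul_right (lconvolution_rlKernel_le hμ hgm hg hα t) _) _)).trans_eq ?_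
    rw [Finset.sum_range_succ _ (n + 1), add_comm 1 (μ * _),
      show μ + μ * (n + 1 : ℕ) = μ * (n + 1 + 1 : ℕ) by push_cast; ring]
    ring

lemma lconvolution_rlKernel_le_mul_lintegral (hg0 : ∀ t < 0, g t = 0) {α : ℝ} (hα : 1 ≤ α)
    (t : ℝ) :
    (g ⋆ₗ rlKernel α) t ≤ ENNReal.ofReal (t ^ (α - 1) / Real.Gamma α) * ∫⁻ y, g y := by
  rw [lconvolution_def, ← lintegral_const_mul' _ _ ENNReal.ofReal_ne_top]
  refine lintegral_mono fun y => ?_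
  rcases lt_or_ge y 0 with hy | hy
  · simp [hg0 y hy]
  rcases le_or_gt (-y + t) 0 with hyt | hyt
  · simp [rlKernel_of_nonpos hyt]
  rw [rlKernel_of_pos hyt, mul_comm]
  have := Real.Gamma_nonneg_of_nonneg (zero_le_one.trans hα)
  gcongr
  linarith

/-- Gronwall's inequality for convolution with the Riemann–Liouville kernel. -/
theorem le_mittagLeffler_of_le_lconvolution_rlKernel (hμ : 0 < μ) (hgm : AEMeasurable g)
    (hgi : ∫⁻ y, g y ≠ ∞) (hg0 : ∀ t < 0, g t = 0) {V c : ℝ} (hV : 0 ≤ V) (hc : 0 ≤ c)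
    (hg : ∀ t, g t ≤ ENNReal.ofReal V * rlKernel 1 t +
      ENNReal.ofReal c * (g ⋆ₗ rlKernel μ) t) {t : ℝ} (ht : 0 < t) :
    g t ≤ ENNReal.ofReal (V * mittagLeffler μ 1 (c * t ^ μ)) := by
  set x : ℝ := c * t ^ μ with hx
  have hx0 : 0 ≤ x := by positivity
  have hpow : ∀ k : ℕ, x ^ k = c ^ k * t ^ (μ * k) := fun k => by
    rw [hx, mul_pow, ← Real.rpow_mul_natCast ht.le]
  have hmain : ∀ n : ℕ, ENNReal.ofReal V *
      ∑ j ∈ Finset.range n, ENNReal.ofReal c ^ j * rlKernel (μ * j + 1) t ≤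
        ENNReal.ofReal (V * mittagLeffler μ 1 x) := by
    intro n
    have hterm : ∀ j : ℕ, ENNReal.ofReal c ^ j * rlKernel (μ * j + 1) t =
        ENNReal.ofReal (x ^ j / Real.Gamma (μ * j + 1)) := fun j => by
      rw [rlKernel_of_pos ht, ← ENNReal.ofReal_pow hc, ← ENNReal.ofReal_mul (by positivity),
        hpow, add_sub_cancel_right, mul_div_assoc]
    have hnonneg : ∀ j : ℕ, 0 ≤ x ^ j / Real.Gamma (μ * j + 1) := fun j =>
      div_nonneg (by positivity) (Real.Gamma_nonneg_of_nonneg (by positivity))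
    simp_rw [hterm]
    rw [← ENNReal.ofReal_sum_of_nonneg fun j _ => hnonneg j, ← ENNReal.ofReal_mul hV]
    gcongr
    exact (summable_pow_div_Gamma hμ 1 hx0).sum_le_tsum _ fun j _ => hnonneg j
  set r : ℕ → ℝ≥0∞ := fun k =>
    ENNReal.ofReal (t⁻¹ * (x ^ k / Real.Gamma (μ * k + 0))) * ∫⁻ y, g y with hr
  have hr0 : Tendsto r atTop (𝓝 0) := by
    have h1 := ((summable_pow_div_Gamma hμ 0 hx0).tendsto_atTop_zero).const_mul t⁻¹
    have h2 := ENNReal.Tendsto.mul_const (ENNReal.tendsto_ofReal h1) (Or.inr hgi)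
    simpa only [mul_zero, ENNReal.ofReal_zero, zero_mul] using h2
  have hlim : Tendsto (fun n => ENNReal.ofReal (V * mittagLeffler μ 1 x) + r (n + 1)) atTop
      (𝓝 (ENNReal.ofReal (V * mittagLeffler μ 1 x))) := by
    simpa using ((tendsto_add_atTop_iff_nat 1).2 hr0).const_add
      (ENNReal.ofReal (V * mittagLeffler μ 1 x))
  have hlarge : ∀ᶠ n : ℕ in atTop, 1 ≤ μ * (n + 1 : ℕ) :=
    ((tendsto_add_atTop_iff_nat 1).2
      (tendsto_natCast_atTop_atTop.const_mul_atTop hμ)).eventually_ge_atTop 1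
  refine ge_of_tendsto hlim ?_
  filter_upwards [hlarge] with n hn
  refine (le_sum_rlKernel_add hμ hgm hg n t).trans (add_le_add (hmain _) ?_)
  refine (mul_le_mul_right (lconvolution_rlKernel_le_mul_lintegral hg0 hn t) _).trans_eq ?_
  rw [hr, ← mul_assoc, ← ENNReal.ofReal_pow hc, ← ENNReal.ofReal_mul (by positivity)]
  congr 2
  rw [hpow, Real.rpow_sub_one ht.ne', add_zero]
  ring

end Volterra

/-- Gronwall–Mittag-Leffler estimate: if `v` is moreover nondecreasing
and `u ≤ v + w ∫ Φ'(Φℓ−Φρ)^{μ−1}u` on `[a,b]`, then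
`u(ℓ) ≤ v(ℓ) E_μ(Γ(μ) w(ℓ) (Φ(ℓ)−Φ(a))^μ)`. -/
theorem gronwall_mittagLeffler_estimate
    (a b : ℝ) (hab : a < b)
    (Φ Φ' : ℝ → ℝ)
    (hΦd : ∀ x ∈ Icc a b, HasDerivAt Φ (Φ' x) x)
    (hΦ'c : ContinuousOn Φ' (Icc a b))
    (hΦ'pos : ∀ x ∈ Icc a b, 0 < Φ' x)
    (μ : ℝ) (hμ : 0 < μ)
    (u v w : ℝ → ℝ)
    (hu0 : ∀ ℓ ∈ Icc a b, 0 ≤ u ℓ)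
    (hv0 : ∀ ℓ ∈ Icc a b, 0 ≤ v ℓ)
    (hui : IntervalIntegrable u MeasureTheory.volume a b)
    (hvi : IntervalIntegrable v MeasureTheory.volume a b)
    (hvmono : MonotoneOn v (Icc a b))
    (hwc : ContinuousOn w (Icc a b))
    (hw0 : ∀ ℓ ∈ Icc a b, 0 ≤ w ℓ)
    (hwmono : MonotoneOn w (Icc a b))
    (hineq : ∀ ℓ ∈ Icc a b,
      u ℓ ≤ v ℓ + w ℓ * ∫ ρ in a..ℓ, Φ' ρ * (Φ ℓ - Φ ρ) ^ (μ - 1) * u ρ) :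
    ∀ ℓ ∈ Icc a b,
      u ℓ ≤ v ℓ * mittagLeffler μ 1 (Real.Gamma μ * w ℓ * (Φ ℓ - Φ a) ^ μ) := by
  intro L hL
  set T : ℝ := Φ L - Φ a with hT
  have hmono : StrictMonoOn Φ (Icc a b) := by
    refine strictMonoOn_of_hasDerivWithinAt_pos (convex_Icc a b)
      (fun x hx => (hΦd x hx).continuousAt.continuousWithinAt)
      (fun x hx => (hΦd x (interior_subset hx)).hasDerivWithinAt)
      fun x hx => hΦ'pos x (interior_subset hx)
  have haI : a ∈ Icc a b := left_mem_Icc.2 hab.le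
  have hΓ := Real.Gamma_pos_of_pos hμ
  rcases hL.1.eq_or_lt with rfl | haL
  · have hone := one_le_mittagLeffler (x := Real.Gamma μ * w a * T ^ μ) hμ (by
      have := hw0 a haI
      rw [hT, sub_self]
      positivity)
    have hua := hineq a haI
    rw [intervalIntegral.integral_same, mul_zero, add_zero] at hua
    exact hua.trans (le_mul_of_one_le_right (hv0 a haI) hone)
  set S : Set ℝ := Ioc a L with hS
  have hSI : S ⊆ Icc a b := fun x hx => ⟨hx.1.le, hx.2.trans hL.2⟩
  set f : ℝ → ℝ := fun x => Φ x - Φ a with hf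
  have hfd : ∀ x ∈ S, HasDerivWithinAt f (Φ' x) S x := fun x hx =>
    ((hΦd x (hSI hx)).sub_const _).hasDerivWithinAt
  have hinj : InjOn f S := fun x hx y hy hxy =>
    hmono.injOn (hSI hx) (hSI hy) (sub_left_injective hxy)
  have hpos : ∀ x ∈ S, 0 < f x := fun x hx => sub_pos.2 (hmono haI (hSI hx) hx.1)
  have hinv : ∀ x ∈ S, Function.invFunOn f S (f x) = x := fun x hx =>
    hinj.leftInvOn_invFunOn hx
  have hfS : MeasurableSet (f '' S) :=
    measurableSet_Ioc.image_of_continuousOn_injOn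
      (fun x hx => (hfd x hx).continuousWithinAt) hinj
  have hint : IntegrableOn (fun t => u (Function.invFunOn f S t)) (f '' S) := by
    rw [integrableOn_image_iff_integrableOn_abs_deriv_smul measurableSet_Ioc hfd hinj]
    have huI : IntegrableOn u (Icc a b) :=
      (intervalIntegrable_iff_integrableOn_Icc_of_le hab.le).1 hui
    refine ((huI.continuousOn_mul hΦ'c.abs isCompact_Icc).mono_set hSI).congr_fun
      (fun x hx => ?_) measurableSet_Ioc
    simp only [hinv x hx, smul_eq_mul]
  set g : ℝ → ℝ≥0∞ :=
    (f '' S).indicator fun t => ENNReal.ofReal (u (Function.invFunOn f S t)) with hg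
  have hgf : ∀ x ∈ S, g (f x) = ENNReal.ofReal (u x) := fun x hx => by
    rw [hg, indicator_of_mem (mem_image_of_mem f hx), hinv x hx]
  have hgm : AEMeasurable g :=
    (aemeasurable_indicator_iff hfS).2 hint.aestronglyMeasurable.aemeasurable.ennreal_ofReal
  have hgi : ∫⁻ t, g t ≠ ∞ := by
    rw [hg, lintegral_indicator hfS]
    exact hint.lintegral_lt_top.ne
  have hg0 : ∀ t < 0, g t = 0 := by
    refine fun t ht => indicator_of_notMem ?_ _
    rintro ⟨x, hx, rfl⟩
    exact ht.not_gt (hpos x hx)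
  have hvolterra : ∀ t, g t ≤ ENNReal.ofReal (v L) * rlKernel 1 t +
      ENNReal.ofReal (Real.Gamma μ * w L) * (g ⋆ₗ rlKernel μ) t := by
    intro t
    by_cases ht : t ∈ f '' S
    swap
    · simp [hg, ht]
    obtain ⟨x, hx, rfl⟩ := ht
    have hxI := hSI hx
    have hk1 : rlKernel 1 (f x) = 1 := by simp [rlKernel_of_pos (hpos x hx)]
    have hconv : ENNReal.ofReal (∫ ρ in a..x, Φ' ρ * (Φ x - Φ ρ) ^ (μ - 1) * u ρ) ≤
        ENNReal.ofReal (Real.Gamma μ) * (g ⋆ₗ rlKernel μ) (f x) := by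
      have hsub : Ioo a x ⊆ S := fun y hy => ⟨hy.1, hy.2.le.trans hx.2⟩
      rw [intervalIntegral.integral_of_le hx.1.le, integral_Ioc_eq_integral_Ioo]
      calc ENNReal.ofReal (∫ ρ in Ioo a x, Φ' ρ * (Φ x - Φ ρ) ^ (μ - 1) * u ρ)
          ≤ ‖∫ ρ in Ioo a x, Φ' ρ * (Φ x - Φ ρ) ^ (μ - 1) * u ρ‖ₑ := ofReal_le_enorm _
        _ ≤ ∫⁻ ρ in Ioo a x, ‖Φ' ρ * (Φ x - Φ ρ) ^ (μ - 1) * u ρ‖ₑ :=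
          enorm_integral_le_lintegral_enorm _
        _ = ∫⁻ ρ in Ioo a x, ENNReal.ofReal (Real.Gamma μ) *
              (ENNReal.ofReal |Φ' ρ| * (g (f ρ) * rlKernel μ (-f ρ + f x))) := by
          refine setLIntegral_congr_fun measurableSet_Ioo fun ρ hρ => ?_
          have hρS := hsub hρ
          have hlt : 0 < Φ x - Φ ρ := sub_pos.2 (hmono (hSI hρS) hxI hρ.2)
          have hu := hu0 ρ (hSI hρS)
          have hΦ' := hΦ'pos ρ (hSI hρS)
          have hdiff : -f ρ + f x = Φ x - Φ ρ := by simp only [hf]; ring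
          simp only [hgf ρ hρS, hdiff, rlKernel_of_pos hlt, abs_of_pos hΦ']
          rw [Real.enorm_of_nonneg (by positivity), ← ENNReal.ofReal_mul hu,
            ← ENNReal.ofReal_mul hΦ'.le, ← ENNReal.ofReal_mul hΓ.le]
          congr 1
          field_simp
        _ ≤ ∫⁻ ρ in S, ENNReal.ofReal (Real.Gamma μ) *
              (ENNReal.ofReal |Φ' ρ| * (g (f ρ) * rlKernel μ (-f ρ + f x))) :=
          lintegral_mono_set hsub
        _ = ENNReal.ofReal (Real.Gamma μ) * ∫⁻ s in f '' S, g s * rlKernel μ (-s + f x) := by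
          rw [lintegral_const_mul' _ _ ENNReal.ofReal_ne_top,
            lintegral_image_eq_lintegral_abs_deriv_mul measurableSet_Ioc hfd hinj]
        _ ≤ ENNReal.ofReal (Real.Gamma μ) * (g ⋆ₗ rlKernel μ) (f x) := by
          rw [lconvolution_def]
          gcongr
          exact Measure.restrict_le_self
    rw [hgf x hx, hk1, mul_one, mul_comm (Real.Gamma μ), ENNReal.ofReal_mul (hw0 L hL), mul_assoc]
    calc ENNReal.ofReal (u x)
        ≤ ENNReal.ofReal (v x + w x * ∫ ρ in a..x, Φ' ρ * (Φ x - Φ ρ) ^ (μ - 1) * u ρ) :=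
          ENNReal.ofReal_le_ofReal (hineq x hxI)
      _ ≤ ENNReal.ofReal (v x) + ENNReal.ofReal (w x) *
            ENNReal.ofReal (∫ ρ in a..x, Φ' ρ * (Φ x - Φ ρ) ^ (μ - 1) * u ρ) := by
          rw [← ENNReal.ofReal_mul (hw0 x hxI)]
          exact ENNReal.ofReal_add_le
      _ ≤ _ := by
          gcongr
          · exact hvmono hxI hL hx.2
          · exact hwmono hxI hL hx.2
  have hLS : L ∈ S := right_mem_Ioc.2 haL
  have hbound := le_mittagLeffler_of_le_lconvolution_rlKernel hμ hgm hgi hg0 (hv0 L hL)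
    (mul_nonneg hΓ.le (hw0 L hL)) hvolterra (hpos L hLS)
  rw [hgf L hLS] at hbound
  have hone := one_le_mittagLeffler (x := Real.Gamma μ * w L * T ^ μ) hμ
    (mul_nonneg (mul_nonneg hΓ.le (hw0 L hL)) (Real.rpow_nonneg (hpos L hLS).le _))
  exact (ENNReal.ofReal_le_ofReal_iff
    (mul_nonneg (hv0 L hL) (zero_le_one.trans hone))).1 hbound
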